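/- Suppose λ1 = λ2 = λ > 0 and (π, ν1, ν2) satisfies the basic adjoint relationship. Then for i ∈ {1,2} the measure νi is absolutely continuous with respect to Lebesgue measure on (0,∞), with density νi(u) = λ² · Σ_{n≥3} ((−1)^{n−1}/12) (n−2)(n−1) n (n+1)(n+2)(n+3)(2n+1) · exp(−(n(n+1)/2) λ u). -/

import Mathlib

open MeasureTheory Set

/-- The boundary density in the symmetric case `λ1 = λ2 = λ`:
`u ↦ λ² Σ_{n≥3} ((−1)^{n−1}/12)(n−2)(n−1)n(n+1)(n+2)(n+3)(2n+1) exp(−(n(n+1)/2)λu)`. -/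
noncomputable def boundaryDensitySym (lam : ℝ) (u : ℝ) : ℝ :=
  lam ^ 2 * ∑' n : ℕ, if 3 ≤ n then
      ((-1 : ℝ) ^ (n - 1) / 12) * ((n : ℝ) - 2) * ((n : ℝ) - 1) * (n : ℝ) * ((n : ℝ) + 1)
        * ((n : ℝ) + 2) * ((n : ℝ) + 3) * (2 * (n : ℝ) + 1)
        * Real.exp (-((n : ℝ) * ((n : ℝ) + 1) / 2 * lam * u))
    else 0

section LaplaceTransform

open Filter Topology Complex

/-! ### Complex Laplace transforms -/

/-- A weighted Laplace transform of a nonnegative function is holomorphic on the right half-plane. -/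
lemma differentiableOn_integral_exp_neg_mul {Ω : Type*} [MeasurableSpace Ω] {μ : Measure Ω}
    [IsFiniteMeasure μ] {X : Ω → ℝ} (hX : Measurable X) (hX0 : ∀ᵐ ω ∂μ, 0 ≤ X ω)
    {W : Ω → ℂ} (hW : Measurable W) (hW1 : ∀ᵐ ω ∂μ, ‖W ω‖ ≤ 1) :
    DifferentiableOn ℂ (fun z : ℂ => ∫ ω, exp (-z * X ω) * W ω ∂μ) {z | 0 < z.re} := by
  intro z₀ hz₀
  have hz₀ : 0 < z₀.re := hz₀
  have hmeas : ∀ z : ℂ, Measurable fun ω => exp (-z * X ω) * W ω := fun z => by fun_prop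
  have hs : {z : ℂ | z₀.re / 2 < z.re} ∈ 𝓝 z₀ :=
    (isOpen_lt continuous_const continuous_re).mem_nhds (by simp only [mem_ofPred_eq]; linarith)
  refine (hasDerivAt_integral_of_dominated_loc_of_deriv_le (μ := μ) (x₀ := z₀)
    (F := fun z ω => exp (-z * X ω) * W ω)
    (F' := fun z ω => exp (-z * X ω) * (-(X ω : ℂ)) * W ω)
    (bound := fun _ => 2 / z₀.re) hs (.of_forall fun z => (hmeas z).aestronglyMeasurable)
    ?_ ?_ ?_ (integrable_const _) ?_).2.differentiableAt.differentiableWithinAt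
  · refine Integrable.of_bound (hmeas z₀).aestronglyMeasurable 1 ?_
    filter_upwards [hX0, hW1] with ω h0 h1
    rw [norm_mul, norm_exp]
    refine mul_le_one₀ (Real.exp_le_one_iff.2 ?_) (norm_nonneg _) h1
    simp only [mul_re, neg_re, ofReal_re, neg_im, ofReal_im, mul_zero, sub_zero]
    nlinarith
  · exact Measurable.aestronglyMeasurable (by fun_prop)
  · filter_upwards [hX0, hW1] with ω h0 h1 z hz
    have hz : z₀.re / 2 < z.re := hz
    rw [norm_mul, norm_mul, norm_exp, norm_neg, norm_real, Real.norm_of_nonneg h0]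
    simp only [mul_re, neg_re, ofReal_re, neg_im, ofReal_im, mul_zero, sub_zero]
    have h2 : Real.exp (-z.re * X ω) ≤ Real.exp (-(z₀.re / 2 * X ω)) :=
      Real.exp_le_exp.2 (by nlinarith)
    have h3 : z₀.re / 2 * X ω ≤ Real.exp (z₀.re / 2 * X ω) := by
      linarith [Real.add_one_le_exp (z₀.re / 2 * X ω)]
    have h4 : X ω * Real.exp (-(z₀.re / 2 * X ω)) ≤ 2 / z₀.re := by
      rw [Real.exp_neg, ← div_eq_mul_inv, div_le_div_iff₀ (Real.exp_pos _) hz₀]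
      linarith
    calc Real.exp (-z.re * X ω) * X ω * ‖W ω‖ ≤ Real.exp (-(z₀.re / 2 * X ω)) * X ω * 1 := by
          gcongr
      _ ≤ 2 / z₀.re := by linarith
  · refine .of_forall fun ω z _ => ?_
    have h := (((hasDerivAt_id z).neg.mul_const (X ω : ℂ)).cexp).mul_const (W ω)
    simpa using h

/-- The Laplace transform of a measure on the real line, as a function of a complex variable. -/
noncomputable def laplaceC (μ : Measure ℝ) (z : ℂ) : ℂ := ∫ u, exp (-z * u) ∂μ

lemma laplaceC_ofReal (μ : Measure ℝ) (x : ℝ) :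
    laplaceC μ x = ((∫ u, Real.exp (-x * u) ∂μ : ℝ) : ℂ) := by
  rw [laplaceC, ← integral_complex_ofReal]
  simp

lemma laplaceC_zero (μ : Measure ℝ) : laplaceC μ 0 = (μ.real univ : ℂ) := by
  simp [laplaceC]

lemma norm_exp_neg_mul_le {z : ℂ} (hz : 0 ≤ z.re) {u : ℝ} (hu : 0 ≤ u) :
    ‖exp (-z * u)‖ ≤ 1 := by
  rw [norm_exp]
  refine Real.exp_le_one_iff.2 ?_
  simp only [mul_re, neg_re, ofReal_re, neg_im, ofReal_im, mul_zero, sub_zero]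
  nlinarith

section Laplace

variable {μ : Measure ℝ} [IsFiniteMeasure μ]

lemma norm_laplaceC_le (hμ : ∀ᵐ u ∂μ, 0 ≤ u) {z : ℂ} (hz : 0 ≤ z.re) :
    ‖laplaceC μ z‖ ≤ μ.real univ := by
  simpa [laplaceC] using norm_integral_le_of_norm_le_const
    (hμ.mono fun u hu => norm_exp_neg_mul_le hz hu)

lemma continuousOn_laplaceC (hμ : ∀ᵐ u ∂μ, 0 ≤ u) :
    ContinuousOn (laplaceC μ) {z | 0 ≤ z.re} := by
  intro z₀ _
  refine tendsto_integral_filter_of_dominated_convergence (fun _ => 1)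
    (.of_forall fun z => Measurable.aestronglyMeasurable (by fun_prop)) ?_
    (integrable_const _) (.of_forall fun u => ?_)
  · filter_upwards [self_mem_nhdsWithin] with z hz
    exact hμ.mono fun u hu => norm_exp_neg_mul_le hz hu
  · exact ((by fun_prop : Continuous fun z : ℂ => exp (-z * u)).tendsto z₀).mono_left
      nhdsWithin_le_nhds

lemma differentiableOn_laplaceC (hμ : ∀ᵐ u ∂μ, 0 ≤ u) :
    DifferentiableOn ℂ (laplaceC μ) {z | 0 < z.re} := by
  have h := differentiableOn_integral_exp_neg_mul (μ := μ) measurable_id hμ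
    (W := fun _ => 1) measurable_const (by simp)
  exact h.congr fun z _ => by simp [laplaceC]

end Laplace

lemma isOpen_re_pos : IsOpen {z : ℂ | 0 < z.re} := isOpen_lt continuous_const continuous_re

/-- Identity theorem on the right half-plane, for functions agreeing at all large reals. -/
lemma eqOn_re_pos_of_eq_ofReal {f g : ℂ → ℂ} (hf : DifferentiableOn ℂ f {z | 0 < z.re})
    (hg : DifferentiableOn ℂ g {z | 0 < z.re}) (c : ℝ)
    (h : ∀ x : ℝ, c < x → 0 < x → f x = g x) : EqOn f g {z | 0 < z.re} := by
  have hx : 0 < max c 0 + 1 := by positivity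
  have hx' : c < max c 0 + 1 := by linarith [le_max_left c 0]
  refine (hf.analyticOnNhd isOpen_re_pos).eqOn_of_preconnected_of_frequently_eq
    (hg.analyticOnNhd isOpen_re_pos) (convex_halfSpace_re_gt 0).isPreconnected
    (z₀ := ((max c 0 + 1 : ℝ) : ℂ)) (by simpa using hx) ?_
  have hev : ∀ᶠ x : ℝ in 𝓝[≠] (max c 0 + 1), f x = g x := by
    filter_upwards [nhdsWithin_le_nhds ((isOpen_Ioi (a := c)).mem_nhds hx'),
      nhdsWithin_le_nhds ((isOpen_Ioi (a := (0 : ℝ))).mem_nhds hx)] with x h1 h2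
    exact h x h1 h2
  have ht : Tendsto (fun x : ℝ => (x : ℂ)) (𝓝[≠] (max c 0 + 1))
      (𝓝[≠] ((max c 0 + 1 : ℝ) : ℂ)) :=
    tendsto_nhdsWithin_of_tendsto_nhds_of_eventually_within _
      (continuous_ofReal.continuousAt.tendsto.mono_left nhdsWithin_le_nhds)
      (eventually_mem_nhdsWithin.mono fun x hx => by
        simpa only [mem_compl_iff, mem_singleton_iff, ofReal_inj] using hx)
  exact ht.frequently hev.frequently

/-- Finite measures on the half-line are determined by their Laplace transform at large reals. -/
lemma measure_eq_of_laplaceC_eq {μ ν : Measure ℝ} [IsFiniteMeasure μ] [IsFiniteMeasure ν]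
    (hμ : ∀ᵐ u ∂μ, 0 ≤ u) (hν : ∀ᵐ u ∂ν, 0 ≤ u) (c : ℝ)
    (h : ∀ x : ℝ, c < x → 0 < x → laplaceC μ x = laplaceC ν x) : μ = ν := by
  have h1 := eqOn_re_pos_of_eq_ofReal (differentiableOn_laplaceC hμ)
    (differentiableOn_laplaceC hν) c h
  have h2 : ∀ s : ℝ, laplaceC μ (-(s * I)) = laplaceC ν (-(s * I)) := by
    intro s
    let p : ℝ → ℂ := fun r => (r : ℂ) - s * I
    have hp : Tendsto p (𝓝[>] 0) (𝓝[{z | 0 ≤ z.re}] (-(s * I))) := by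
      refine tendsto_nhdsWithin_of_tendsto_nhds_of_eventually_within _ ?_ ?_
      · have : Tendsto p (𝓝 0) (𝓝 (p 0)) :=
          (by fun_prop : Continuous p).tendsto 0
        simpa [p] using this.mono_left nhdsWithin_le_nhds
      · filter_upwards [self_mem_nhdsWithin] with r hr
        simpa [p] using (le_of_lt hr : (0:ℝ) ≤ r)
    have hm : (-(s * I) : ℂ) ∈ {z : ℂ | 0 ≤ z.re} := by simp
    refine tendsto_nhds_unique ((continuousOn_laplaceC hμ _ hm).tendsto.comp hp)
      (((continuousOn_laplaceC hν _ hm).tendsto.comp hp).congr' ?_)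
    filter_upwards [self_mem_nhdsWithin] with r hr
    exact (h1 (by simpa [p] using (hr : (0:ℝ) < r))).symm
  refine Measure.ext_of_charFun (funext fun s => ?_)
  rw [charFun_apply_real, charFun_apply_real]
  have := h2 s
  simpa [laplaceC, mul_comm, mul_left_comm, mul_assoc] using this

/-! ### The maximum principle on a strip with reflection symmetries -/

/-- A holomorphic function on the strip `-1 < re t < 1` that is invariant under the reflections
`t ↦ -1 - t` and `t ↦ 1 - t` of the half-strips and tends to zero at infinity vanishes. -/
lemma eq_zero_of_reflection_symmetric {f : ℂ → ℂ}
    (hf : DifferentiableOn ℂ f {t | -1 < t.re ∧ t.re < 1})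
    (hl : ∀ t : ℂ, -1 < t.re → t.re < 0 → f (-1 - t) = f t)
    (hr : ∀ t : ℂ, 0 < t.re → t.re < 1 → f (1 - t) = f t)
    (hdecay : ∀ ε > 0, ∃ R : ℝ, ∀ t : ℂ, -1 < t.re → t.re < 1 → R ≤ |t.im| → ‖f t‖ ≤ ε)
    {t : ℂ} (ht₁ : -1 < t.re) (ht₂ : t.re < 1) : f t = 0 := by
  by_contra hne
  obtain ⟨R, hR⟩ := hdecay (‖f t‖ / 2) (by positivity)
  have hpos : 0 < ‖f t‖ := norm_pos_iff.2 hne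
  set V : Set ℂ := {t | -1 < t.re ∧ t.re < 1} with hV
  have hVo : IsOpen V := (isOpen_lt continuous_const continuous_re).inter
    (isOpen_lt continuous_re continuous_const)
  have hVc : IsPreconnected V :=
    ((convex_halfSpace_re_gt (-1)).inter (convex_halfSpace_re_lt 1)).isPreconnected
  set K : Set ℂ := Icc (-1/2 : ℝ) (1/2) ×ℂ Icc (-R) R with hK
  have hKc : IsCompact K := isCompact_Icc.reProdIm isCompact_Icc
  have hKV : K ⊆ V := fun z hz => by
    obtain ⟨⟨h1, h2⟩, -⟩ := mem_reProdIm.1 hz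
    exact ⟨by linarith, by linarith⟩
  have hfold : ∀ s ∈ V, ∃ s' : ℂ, -1/2 ≤ s'.re ∧ s'.re ≤ 1/2 ∧ f s' = f s := by
    rintro s ⟨h1, h2⟩
    rcases lt_or_ge s.re (-1/2) with h3 | h3
    · exact ⟨-1 - s, by simp; linarith, by simp; linarith, hl s h1 (by linarith)⟩
    rcases lt_or_ge (1/2) s.re with h4 | h4
    · exact ⟨1 - s, by simp; linarith, by simp; linarith, hr s (by linarith) h2⟩
    · exact ⟨s, h3, h4, rfl⟩
  have hfoldK : ∀ s ∈ V, ‖f t‖ / 2 < ‖f s‖ → ∃ s' ∈ K, f s' = f s := by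
    intro s hs hlt
    obtain ⟨s', h1, h2, h3⟩ := hfold s hs
    refine ⟨s', mem_reProdIm.2 ⟨⟨h1, h2⟩, abs_le.1 ?_⟩, h3⟩
    by_contra! hlt'
    have := hR s' (by linarith) (by linarith) hlt'.le
    rw [h3] at this
    linarith
  obtain ⟨t', ht'K, ht'⟩ := hfoldK t ⟨ht₁, ht₂⟩ (by linarith)
  obtain ⟨m, hmK, hm⟩ := hKc.exists_isMaxOn ⟨t', ht'K⟩ ((hf.continuousOn.mono hKV).norm)
  have hmt : ‖f t‖ ≤ ‖f m‖ := by
    rw [← ht']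
    exact hm ht'K
  have hmax : IsMaxOn (norm ∘ f) V m := by
    intro s hs
    change ‖f s‖ ≤ ‖f m‖
    by_cases hlt : ‖f t‖ / 2 < ‖f s‖
    · obtain ⟨s', h1, h2⟩ := hfoldK s hs hlt
      rw [← h2]
      exact hm h1
    · linarith
  have hconst := Complex.eqOn_of_isPreconnected_of_isMaxOn_norm hVc hVo hf (hKV hmK) hmax
  have hR' := hR (R * I) (by simp) (by simp) (by simpa using le_abs_self R)
  have heq : f (R * I) = f m := hconst (show (R * I : ℂ) ∈ V from ⟨by simp, by simp⟩)
  rw [heq] at hR'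
  linarith

/-! ### Uniformization of the kernel -/

/-- The polynomial `(t-2)(t-1)t(t+1)(t+2)(t+3)`. -/
def sexticPoly (t : ℂ) : ℂ := (t - 2) * (t - 1) * t * (t + 1) * (t + 2) * (t + 3)

/-- The point `(uniformY lam (-t), uniformY lam t)` runs over the zero set of the kernel
`(x - y)² + lam (x + y)`. -/
noncomputable def uniformY (lam : ℝ) (t : ℂ) : ℂ := -(lam * (t * (t + 1)) / 2)

/-- The difference between `laplaceC ν (uniformY lam t)` and its expected closed form
`(π lam / 6) * sexticPoly t / sin (π t)`, divided by `sexticPoly t`. -/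
noncomputable def laplaceDefect (lam : ℝ) (ν : Measure ℝ) (t : ℂ) : ℂ :=
  laplaceC ν (uniformY lam t) / sexticPoly t - (Real.pi * lam / 6) / sin (Real.pi * t)

lemma uniformY_re (lam : ℝ) (t : ℂ) :
    (uniformY lam t).re = lam / 2 * (t.im ^ 2 - t.re * (t.re + 1)) := by
  have : uniformY lam t = ((-lam / 2 : ℝ) : ℂ) * (t * (t + 1)) := by
    simp [uniformY]; ring
  rw [this, re_ofReal_mul]
  simp; ring

lemma uniformY_re_nonneg {lam : ℝ} (hlam : 0 < lam) {t : ℂ} (h₁ : -1 ≤ t.re) (h₂ : t.re ≤ 0) :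
    0 ≤ (uniformY lam t).re := by
  rw [uniformY_re]
  have : t.re * (t.re + 1) ≤ 0 := mul_nonpos_of_nonpos_of_nonneg h₂ (by linarith)
  have := sq_nonneg t.im
  exact mul_nonneg (by positivity) (by linarith)

lemma uniformY_re_pos {lam : ℝ} (hlam : 0 < lam) {t : ℂ} (h₁ : -1 < t.re) (h₂ : t.re ≤ 0)
    (ht : t ≠ 0) : 0 < (uniformY lam t).re := by
  rw [uniformY_re]
  refine mul_pos (by positivity) ?_
  have h0 := sq_nonneg t.im
  rcases h₂.lt_or_eq with h | h
  · have : t.re * (t.re + 1) < 0 := mul_neg_of_neg_of_pos h (by linarith)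
    linarith
  · have : t.im ≠ 0 := fun h' => ht (Complex.ext h h')
    rw [h]
    have := sq_pos_of_ne_zero this
    linarith

lemma sexticPoly_ne_zero {t : ℂ} (h₁ : -1 < t.re) (h₂ : t.re < 1) (ht : t ≠ 0) :
    sexticPoly t ≠ 0 := by
  have key : ∀ c : ℝ, (c ≤ -1 ∨ 1 ≤ c) → t + c ≠ 0 := by
    intro c hc h
    have := congrArg re h
    simp at this
    rcases hc with hc | hc <;> linarith
  have e1 := key (-2) (by norm_num)
  have e2 := key (-1) (by norm_num)
  have e3 := key 1 (by norm_num)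
  have e4 := key 2 (by norm_num)
  have e5 := key 3 (by norm_num)
  push_cast at e1 e2 e3 e4 e5
  rw [← sub_eq_add_neg] at e1 e2
  simp [sexticPoly, *]

lemma sin_pi_mul_ne_zero_of_strip {t : ℂ} (h₁ : -1 < t.re) (h₂ : t.re < 1) (ht : t ≠ 0) :
    sin (Real.pi * t) ≠ 0 := by
  refine sin_pi_mul_ne_zero ?_
  rintro ⟨n, hn⟩
  rw [← hn] at h₁ h₂ ht
  simp only [intCast_re] at h₁ h₂
  have h₁' : -1 < n := by exact_mod_cast h₁
  have h₂' : n < 1 := by exact_mod_cast h₂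
  exact ht (by rw [show n = 0 by omega]; simp)

lemma laplaceDefect_reflect (lam : ℝ) (ν : Measure ℝ) (t : ℂ) :
    laplaceDefect lam ν (-1 - t) = laplaceDefect lam ν t := by
  have h1 : uniformY lam (-1 - t) = uniformY lam t := by simp only [uniformY]; ring
  have h2 : sexticPoly (-1 - t) = sexticPoly t := by simp only [sexticPoly]; ring
  have h3 : sin (Real.pi * (-1 - t)) = sin (Real.pi * t) := by
    rw [show (Real.pi * (-1 - t) : ℂ) = -(Real.pi * t + Real.pi) by ring, sin_neg, sin_add_pi,
      neg_neg]
  rw [laplaceDefect, laplaceDefect, h1, h2, h3]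

section Defect

variable {lam : ℝ} {ν : Measure ℝ} [IsFiniteMeasure ν]

lemma differentiableAt_laplaceDefect (hlam : 0 < lam) (hν : ∀ᵐ u ∂ν, 0 ≤ u) {t : ℂ}
    (h₁ : -1 < t.re) (h₂ : t.re ≤ 0) (ht : t ≠ 0) :
    DifferentiableAt ℂ (laplaceDefect lam ν) t := by
  have hY : DifferentiableAt ℂ (laplaceC ν) (uniformY lam t) :=
    (differentiableOn_laplaceC hν).differentiableAt
      (isOpen_re_pos.mem_nhds (uniformY_re_pos hlam h₁ h₂ ht))
  have hU : DifferentiableAt ℂ (uniformY lam) t := by unfold uniformY; fun_prop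
  have hP : DifferentiableAt ℂ sexticPoly t := by unfold sexticPoly; fun_prop
  have hS : DifferentiableAt ℂ (fun t : ℂ => sin (Real.pi * t)) t := by fun_prop
  exact ((hY.comp t hU).div hP (sexticPoly_ne_zero h₁ (by linarith) ht)).sub
    ((differentiableAt_const _).div hS (sin_pi_mul_ne_zero_of_strip h₁ (by linarith) ht))

lemma le_norm_sin_pi_mul (t : ℂ) : |t.im| ≤ ‖sin (Real.pi * t)‖ := by
  have key : ∀ s : ℂ, 0 ≤ s.im → s.im ≤ ‖sin (Real.pi * s)‖ := by
    intro s hs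
    have h1 : ‖exp (-(Real.pi * s) * I)‖ = Real.exp (Real.pi * s.im) := by
      rw [norm_exp]; simp
    have h2 : ‖exp ((Real.pi * s) * I)‖ = Real.exp (-(Real.pi * s.im)) := by
      rw [norm_exp]; simp
    have h3 : ‖sin (Real.pi * s)‖
        = ‖exp (-(Real.pi * s) * I) - exp ((Real.pi * s) * I)‖ / 2 := by
      rw [sin]; simp
    have h4 := norm_sub_norm_le (exp (-(Real.pi * s) * I)) (exp ((Real.pi * s) * I))
    have h0 : 0 ≤ Real.pi * s.im := mul_nonneg Real.pi_pos.le hs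
    have h5 : Real.exp (-(Real.pi * s.im)) ≤ 1 := Real.exp_le_one_iff.2 (by linarith)
    have h6 := Real.add_one_le_exp (Real.pi * s.im)
    have h7 : 2 * s.im ≤ Real.pi * s.im := mul_le_mul_of_nonneg_right Real.two_le_pi hs
    rw [h3, le_div_iff₀ two_pos]
    linarith
  rcases le_total 0 t.im with h | h
  · rw [abs_of_nonneg h]
    exact key t h
  · rw [abs_of_nonpos h]
    have := key (-t) (by simpa using h)
    simpa using this

lemma le_norm_sexticPoly {t : ℂ} (ht : 1 ≤ |t.im|) : |t.im| ≤ ‖sexticPoly t‖ := by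
  have key : ∀ c : ℝ, |t.im| ≤ ‖t + c‖ := fun c => by
    simpa using abs_im_le_norm (t + c)
  have e1 := key (-2)
  have e2 := key (-1)
  have e0 := key 0
  have e3 := key 1
  have e4 := key 2
  have e5 := key 3
  push_cast at e0 e1 e2 e3 e4 e5
  rw [← sub_eq_add_neg] at e1 e2
  rw [add_zero] at e0
  simp only [sexticPoly, norm_mul]
  calc |t.im| = 1 * 1 * |t.im| * 1 * 1 * 1 := by ring
    _ ≤ _ := by gcongr <;> linarith

lemma norm_laplaceDefect_le (hlam : 0 < lam) (hν : ∀ᵐ u ∂ν, 0 ≤ u) {t : ℂ}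
    (h₁ : -1 ≤ t.re) (h₂ : t.re ≤ 0) (ht : 1 ≤ |t.im|) :
    ‖laplaceDefect lam ν t‖ ≤ (ν.real univ + Real.pi * lam / 6) / |t.im| := by
  have hpos : 0 < |t.im| := by linarith
  have hc : ‖(Real.pi * lam / 6 : ℂ)‖ = Real.pi * lam / 6 := by
    rw [show (Real.pi * lam / 6 : ℂ) = ((Real.pi * lam / 6 : ℝ) : ℂ) by push_cast; rfl, norm_real,
      Real.norm_of_nonneg (by positivity)]
  refine (norm_sub_le _ _).trans ?_
  rw [norm_div, norm_div, hc, add_div]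
  gcongr
  · exact norm_laplaceC_le hν (uniformY_re_nonneg hlam h₁ h₂)
  · exact le_norm_sexticPoly ht
  · exact le_norm_sin_pi_mul t

lemma tendsto_mul_laplaceDefect (hlam : 0 < lam) (hν : ∀ᵐ u ∂ν, 0 ≤ u)
    (hmass : ν.real univ = 2 * lam) :
    Tendsto (fun t => t * laplaceDefect lam ν t)
      (𝓝[{t | -1 ≤ t.re ∧ t.re ≤ 0 ∧ t ≠ 0}] 0) (𝓝 0) := by
  set s : Set ℂ := {t | -1 ≤ t.re ∧ t.re ≤ 0 ∧ t ≠ 0}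
  have hU : Tendsto (uniformY lam) (𝓝[s] 0) (𝓝[{z | 0 ≤ z.re}] 0) := by
    refine tendsto_nhdsWithin_of_tendsto_nhds_of_eventually_within _ ?_ ?_
    · have : Continuous (uniformY lam) := by unfold uniformY; fun_prop
      simpa [uniformY] using (this.tendsto 0).mono_left (nhdsWithin_le_nhds (s := s))
    · filter_upwards [self_mem_nhdsWithin] with t ht
      exact uniformY_re_nonneg hlam ht.1 ht.2.1
  have hL : Tendsto (fun t => laplaceC ν (uniformY lam t)) (𝓝[s] 0) (𝓝 (2 * lam)) := by
    have h := (continuousOn_laplaceC hν 0 (by simp)).tendsto.comp hU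
    rw [laplaceC_zero, hmass] at h
    push_cast at h
    exact h
  have hP : Tendsto (fun t : ℂ => (t - 2) * (t - 1) * (t + 1) * (t + 2) * (t + 3)) (𝓝[s] 0)
      (𝓝 12) := by
    have h : Continuous fun t : ℂ => (t - 2) * (t - 1) * (t + 1) * (t + 2) * (t + 3) := by fun_prop
    have h' := (h.tendsto 0).mono_left (nhdsWithin_le_nhds (s := s))
    norm_num at h'
    exact h'
  have hS : Tendsto (fun t : ℂ => t⁻¹ * sin (Real.pi * t)) (𝓝[s] 0) (𝓝 Real.pi) := by
    have h : HasDerivAt (fun t : ℂ => sin (Real.pi * t)) (Real.pi : ℂ) 0 := by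
      simpa using ((hasDerivAt_id (0 : ℂ)).const_mul (Real.pi : ℂ)).csin
    have h' := h.tendsto_slope
    refine (h'.mono_left (nhdsWithin_mono 0 fun t ht => ht.2.2)).congr fun t => ?_
    simp [slope_def_field, div_eq_inv_mul]
  have hpi : (Real.pi : ℂ) ≠ 0 := ofReal_ne_zero.2 Real.pi_ne_zero
  have hlim := (hL.div hP (by norm_num)).sub
    ((tendsto_const_nhds (x := (Real.pi * lam / 6 : ℂ))).div hS hpi)
  have h0 : (2 * lam / 12 - (Real.pi * lam / 6) / Real.pi : ℂ) = 0 := by field_simp; ring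
  rw [h0] at hlim
  refine hlim.congr' ?_
  filter_upwards [self_mem_nhdsWithin] with t ht
  have ht0 : t ≠ 0 := ht.2.2
  simp only [laplaceDefect, sexticPoly, Pi.div_apply]
  rw [mul_sub t, show (t - 2) * (t - 1) * t * (t + 1) * (t + 2) * (t + 3)
    = t * ((t - 2) * (t - 1) * (t + 1) * (t + 2) * (t + 3)) by ring]
  congr 1
  · rw [← mul_div_assoc, mul_div_mul_left _ _ ht0]
  · rw [div_mul_eq_div_div, div_inv_eq_mul]
    ring

end Defect

/-! ### Consequences of the basic adjoint relationship -/

/-- Dividing the relationship on an axis by its coordinate and letting it tend to `0`. -/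
lemma mass_relation {lam m : ℝ} {pim : Measure (ℝ × ℝ)} [IsProbabilityMeasure pim]
    {Z : ℝ × ℝ → ℝ} (hZ : Measurable Z) (h₁ : ∀ᵐ p ∂pim, 0 ≤ Z p)
    {ν : Measure ℝ} [IsFiniteMeasure ν] (hν : ∀ᵐ u ∂ν, 0 ≤ u)
    (h : ∀ x > (0:ℝ), (x ^ 2 + lam * x) * (∫ p, Real.exp (-x * Z p) ∂pim)
        = x * m - x / 2 * (∫ u, Real.exp (-x * u) ∂ν)) :
    lam = m - ν.real univ / 2 := by
  have key : ∀ {Ω : Type} [MeasurableSpace Ω] (μ : Measure Ω) [IsFiniteMeasure μ] (X : Ω → ℝ)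
      (_ : Measurable X) (_ : ∀ᵐ ω ∂μ, 0 ≤ X ω),
      Tendsto (fun x : ℝ => ∫ ω, Real.exp (-x * X ω) ∂μ) (𝓝[>] 0) (𝓝 (μ.real univ)) := by
    intro Ω _ μ _ X hX hX0
    have h0 : μ.real univ = ∫ ω, Real.exp (-0 * X ω) ∂μ := by simp
    rw [h0]
    refine tendsto_integral_filter_of_dominated_convergence (fun _ => 1)
      (.of_forall fun z => Measurable.aestronglyMeasurable (by fun_prop)) ?_
      (integrable_const _) (.of_forall fun u => ?_)
    · filter_upwards [self_mem_nhdsWithin] with x hx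
      filter_upwards [hX0] with ω hω
      have hx : 0 < x := hx
      rw [Real.norm_of_nonneg (Real.exp_pos _).le]
      exact Real.exp_le_one_iff.2 (by nlinarith)
    · exact ((by fun_prop : Continuous fun x : ℝ => Real.exp (-x * X u)).tendsto 0).mono_left
        nhdsWithin_le_nhds
  have hid : Tendsto (fun x : ℝ => x + lam) (𝓝[>] 0) (𝓝 (0 + lam)) :=
    ((by fun_prop : Continuous fun x : ℝ => x + lam).tendsto 0).mono_left nhdsWithin_le_nhds
  have hl := hid.mul (key pim Z hZ h₁)
  have hr := (tendsto_const_nhds (x := m)).sub ((key ν id measurable_id hν).div_const 2)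
  have := tendsto_nhds_unique (hl.congr' ?_) hr
  · simpa using this
  · filter_upwards [self_mem_nhdsWithin] with x hx
    have hx : 0 < x := hx
    have hx' := h x hx
    refine mul_left_cancel₀ hx.ne' ?_
    simp only [id]
    linear_combination hx'

lemma laplaceDefect_neg_of_bar {lam : ℝ} {nu1 nu2 : Measure ℝ} (hlam : 0 < lam)
    (hbar : ∀ x y : ℂ, 0 < x.re → 0 < y.re → (x - y) ^ 2 + lam * x + lam * y = 0 →
      (x - y / 2) * laplaceC nu1 y + (y - x / 2) * laplaceC nu2 x = 0)
    {t : ℂ} (h₁ : 0 < (uniformY lam t).re) (h₂ : 0 < (uniformY lam (-t)).re)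
    (hP₁ : sexticPoly t ≠ 0) (hP₂ : sexticPoly (-t) ≠ 0) :
    laplaceDefect lam nu1 t = -laplaceDefect lam nu2 (-t) := by
  have h := hbar _ _ h₂ h₁ (by simp only [uniformY]; ring)
  have hl : (lam : ℂ) ≠ 0 := ofReal_ne_zero.2 hlam.ne'
  have h' : t * (t - 3) * laplaceC nu1 (uniformY lam t)
      + t * (t + 3) * laplaceC nu2 (uniformY lam (-t)) = 0 := by
    refine (mul_eq_zero.1 ?_).resolve_left (mul_ne_zero hl (by norm_num : (-1 / 4 : ℂ) ≠ 0))
    rw [← h]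
    conv_rhs => enter [1, 1]; simp only [uniformY]
    conv_rhs => enter [2, 1]; simp only [uniformY]
    ring
  have hq : laplaceC nu1 (uniformY lam t) / sexticPoly t
      = -(laplaceC nu2 (uniformY lam (-t)) / sexticPoly (-t)) := by
    rw [← neg_div, div_eq_div_iff hP₁ hP₂]
    simp only [sexticPoly]
    linear_combination (t - 2) * (t - 1) * (t + 1) * (t + 2) * h'
  rw [laplaceDefect, laplaceDefect, hq, mul_neg, sin_neg, div_neg]
  ring

section BAR

variable {lam : ℝ} {pim : Measure (ℝ × ℝ)} [IsProbabilityMeasure pim]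
  {nu1 nu2 : Measure ℝ} [IsFiniteMeasure nu1] [IsFiniteMeasure nu2]

/-- The basic adjoint relationship extends to complex arguments with positive real parts. -/
lemma bar_complex (h₁ : ∀ᵐ p ∂pim, 0 ≤ p.1) (h₂ : ∀ᵐ p ∂pim, 0 ≤ p.2)
    (hnu1 : ∀ᵐ u ∂nu1, 0 ≤ u) (hnu2 : ∀ᵐ u ∂nu2, 0 ≤ u)
    (hBAR : ∀ x ≥ (0:ℝ), ∀ y ≥ (0:ℝ),
      ((x - y) ^ 2 + lam * x + lam * y) * (∫ p, Real.exp (-x * p.1 - y * p.2) ∂pim)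
        = (x - y / 2) * (∫ u, Real.exp (-y * u) ∂nu1)
          + (y - x / 2) * (∫ u, Real.exp (-x * u) ∂nu2))
    {x y : ℂ} (hx : 0 < x.re) (hy : 0 < y.re) :
    ((x - y) ^ 2 + lam * x + lam * y) * (∫ p, exp (-x * p.1) * exp (-y * p.2) ∂pim)
      = (x - y / 2) * laplaceC nu1 y + (y - x / 2) * laplaceC nu2 x := by
  have hreal : ∀ a b : ℝ, 0 < a → 0 < b →
      (((a : ℂ) - b) ^ 2 + lam * a + lam * b)
          * (∫ p : ℝ × ℝ, exp (-(a : ℂ) * p.1) * exp (-(b : ℂ) * p.2) ∂pim)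
        = ((a : ℂ) - b / 2) * laplaceC nu1 b + ((b : ℂ) - a / 2) * laplaceC nu2 a := by
    intro a b ha hb
    have h : (∫ p : ℝ × ℝ, exp (-(a : ℂ) * p.1) * exp (-(b : ℂ) * p.2) ∂pim)
        = ((∫ p, Real.exp (-a * p.1 - b * p.2) ∂pim : ℝ) : ℂ) := by
      rw [← integral_complex_ofReal]
      refine integral_congr_ae (.of_forall fun p => ?_)
      simp only [ofReal_exp]
      rw [← exp_add]
      congr 1
      push_cast
      ring
    rw [h, laplaceC_ofReal, laplaceC_ofReal]
    exact_mod_cast hBAR a ha.le b hb.le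
  have hmix : ∀ b : ℝ, 0 < b → ∀ z : ℂ, 0 < z.re →
      ((z - b) ^ 2 + lam * z + lam * b)
          * (∫ p : ℝ × ℝ, exp (-z * p.1) * exp (-(b : ℂ) * p.2) ∂pim)
        = (z - b / 2) * laplaceC nu1 b + (b - z / 2) * laplaceC nu2 z := by
    intro b hb z hz
    refine eqOn_re_pos_of_eq_ofReal
      (f := fun z => ((z - b) ^ 2 + lam * z + lam * b)
          * (∫ p : ℝ × ℝ, exp (-z * p.1) * exp (-(b : ℂ) * p.2) ∂pim))
      (g := fun z => (z - b / 2) * laplaceC nu1 b + (b - z / 2) * laplaceC nu2 z)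
      ?_ ?_ 0 (fun a ha _ => hreal a b ha hb) hz
    · refine DifferentiableOn.mul (by fun_prop) (differentiableOn_integral_exp_neg_mul
        measurable_fst h₁ (by fun_prop) ?_)
      filter_upwards [h₂] with p hp
      exact norm_exp_neg_mul_le (by simpa using hb.le) hp
    · have := differentiableOn_laplaceC hnu2
      fun_prop
  refine eqOn_re_pos_of_eq_ofReal
    (f := fun y => ((x - y) ^ 2 + lam * x + lam * y)
        * (∫ p : ℝ × ℝ, exp (-x * p.1) * exp (-y * p.2) ∂pim))
    (g := fun y => (x - y / 2) * laplaceC nu1 y + (y - x / 2) * laplaceC nu2 x)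
    ?_ ?_ 0 (fun b hb _ => hmix b hb x hx) hy
  · refine DifferentiableOn.mul (by fun_prop) ?_
    refine (differentiableOn_integral_exp_neg_mul (μ := pim) (W := fun p => exp (-x * p.1))
        measurable_snd h₂ (by fun_prop) ?_).congr fun z _ => by simp only [mul_comm]
    filter_upwards [h₁] with p hp
    exact norm_exp_neg_mul_le hx.le hp
  · have := differentiableOn_laplaceC hnu1
    fun_prop

/-- The two defects glue to a holomorphic function on the strip `-1 < re t < 1`, which vanishes. -/
lemma laplaceDefect_eq_zero_of_bar (hlam : 0 < lam)
    (hnu1 : ∀ᵐ u ∂nu1, 0 ≤ u) (hnu2 : ∀ᵐ u ∂nu2, 0 ≤ u)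
    (hm1 : nu1.real univ = 2 * lam) (hm2 : nu2.real univ = 2 * lam)
    (hbar : ∀ x y : ℂ, 0 < x.re → 0 < y.re → (x - y) ^ 2 + lam * x + lam * y = 0 →
      (x - y / 2) * laplaceC nu1 y + (y - x / 2) * laplaceC nu2 x = 0)
    {t : ℂ} (ht₁ : -1 < t.re) (ht₂ : t.re < 0) :
    laplaceDefect lam nu1 t = 0 ∧ laplaceDefect lam nu2 t = 0 := by
  set f : ℂ → ℂ := fun t =>
    if t.re ≤ 0 then laplaceDefect lam nu1 t else -laplaceDefect lam nu2 (-t) with hf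
  have hfl : ∀ t : ℂ, t.re ≤ 0 → f t = laplaceDefect lam nu1 t := fun t h => by simp [hf, h]
  have hfr : ∀ t : ℂ, 0 < t.re → f t = -laplaceDefect lam nu2 (-t) :=
    fun t h => by simp [hf, not_le.2 h]
  set V : Set ℂ := {t | -1 < t.re ∧ t.re < 1} with hV
  have hVo : IsOpen V := (isOpen_lt continuous_const continuous_re).inter
    (isOpen_lt continuous_re continuous_const)
  have hV0 : V ∈ 𝓝 0 := hVo.mem_nhds ⟨by simp, by simp⟩
  have hYc : Continuous (uniformY lam) := by unfold uniformY; fun_prop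
  have hd : DifferentiableOn ℂ f (V \ {0}) := by
    rintro t ⟨⟨h1, h2⟩, h0⟩
    have h0 : t ≠ 0 := h0
    refine DifferentiableAt.differentiableWithinAt ?_
    rcases lt_trichotomy t.re 0 with h | h | h
    · refine (differentiableAt_laplaceDefect hlam hnu1 h1 h.le h0).congr_of_eventuallyEq ?_
      filter_upwards [(isOpen_lt continuous_re continuous_const).mem_nhds h] with s hs
      exact hfl s (le_of_lt hs)
    · refine (differentiableAt_laplaceDefect hlam hnu1 h1 h.le h0).congr_of_eventuallyEq ?_
      have hy : 0 < (uniformY lam t).re := uniformY_re_pos hlam h1 h.le h0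
      have hx : 0 < (uniformY lam (-t)).re :=
        uniformY_re_pos hlam (by simp [h]) (by simp [h]) (neg_ne_zero.2 h0)
      filter_upwards [(isOpen_re_pos.preimage hYc).mem_nhds hy,
        (isOpen_re_pos.preimage (hYc.comp continuous_neg)).mem_nhds hx, hVo.mem_nhds ⟨h1, h2⟩,
        isOpen_ne.mem_nhds h0] with s hs1 hs2 hs3 hs4
      by_cases hs : s.re ≤ 0
      · exact hfl s hs
      · rw [hfr s (not_le.1 hs)]
        exact (laplaceDefect_neg_of_bar hlam hbar hs1 hs2 (sexticPoly_ne_zero hs3.1 hs3.2 hs4)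
          (sexticPoly_ne_zero (by simpa using hs3.2) (by simpa using neg_lt.1 hs3.1)
            (neg_ne_zero.2 hs4))).symm
    · have hn : DifferentiableAt ℂ (laplaceDefect lam nu2) (-t) :=
        differentiableAt_laplaceDefect hlam hnu2 (by simpa using h2) (by simpa using h.le)
          (neg_ne_zero.2 h0)
      refine ((hn.comp t differentiable_neg.differentiableAt).neg).congr_of_eventuallyEq ?_
      filter_upwards [(isOpen_lt continuous_const continuous_re).mem_nhds h] with s hs
      exact hfr s hs
  have hlim : Tendsto (fun t => t * f t) (𝓝[≠] 0) (𝓝 0) := by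
    have hl : Tendsto (fun t => t * f t) (𝓝[{t | -1 ≤ t.re ∧ t.re ≤ 0 ∧ t ≠ 0}] 0) (𝓝 0) := by
      refine (tendsto_mul_laplaceDefect hlam hnu1 hm1).congr' ?_
      filter_upwards [self_mem_nhdsWithin] with s hs
      rw [hfl s hs.2.1]
    have hr : Tendsto (fun t => t * f t) (𝓝[{t | 0 < t.re ∧ t.re ≤ 1}] 0) (𝓝 0) := by
      have hneg : Tendsto (fun t : ℂ => -t) (𝓝[{t | 0 < t.re ∧ t.re ≤ 1}] 0)
          (𝓝[{t | -1 ≤ t.re ∧ t.re ≤ 0 ∧ t ≠ 0}] 0) := by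
        refine tendsto_nhdsWithin_of_tendsto_nhds_of_eventually_within _ ?_ ?_
        · simpa using (continuous_neg.tendsto (0 : ℂ)).mono_left
            (nhdsWithin_le_nhds (s := {t : ℂ | 0 < t.re ∧ t.re ≤ 1}))
        · filter_upwards [self_mem_nhdsWithin] with s hs
          refine ⟨by simpa using hs.2, by simpa using hs.1.le, ?_⟩
          rintro h
          have := hs.1
          rw [neg_eq_zero.1 h] at this
          simp at this
      refine ((tendsto_mul_laplaceDefect hlam hnu2 hm2).comp hneg).congr' ?_
      filter_upwards [self_mem_nhdsWithin] with s hs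
      rw [hfr s hs.1]
      simp
    refine (hl.sup hr).mono_left ?_
    rw [← nhdsWithin_union, nhdsWithin_le_iff]
    filter_upwards [nhdsWithin_le_nhds hV0, self_mem_nhdsWithin] with s hs hs0
    rcases le_or_gt s.re 0 with h | h
    · exact Or.inl ⟨hs.1.le, h, hs0⟩
    · exact Or.inr ⟨h, hs.2.le⟩
  set F : ℂ → ℂ := Function.update f 0 (limUnder (𝓝[≠] 0) f) with hF
  have hFd : DifferentiableOn ℂ F V := by
    refine Complex.differentiableOn_update_limUnder_of_isLittleO hV0 hd ?_
    refine (Asymptotics.isLittleO_iff_tendsto' ?_).2 ?_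
    · filter_upwards [self_mem_nhdsWithin] with s hs h
      exact absurd h (by simpa using hs)
    · have h1 : Tendsto (fun s : ℂ => s * f 0) (𝓝[≠] 0) (𝓝 0) := by
        have := ((continuous_mul_const (f 0)).tendsto (0 : ℂ)).mono_left
          (nhdsWithin_le_nhds (s := {0}ᶜ))
        simpa using this
      refine ((hlim.sub h1).congr fun s => ?_).trans (by simp)
      simp only [sub_zero, div_inv_eq_mul]
      ring
  have hFf : ∀ s : ℂ, s.re ≠ 0 → F s = f s := by
    intro s hs
    refine Function.update_of_ne ?_ _ _
    rintro rfl
    simp at hs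
  have hzero : ∀ s ∈ V, F s = 0 := by
    intro s hs
    refine eq_zero_of_reflection_symmetric hFd ?_ ?_ ?_ hs.1 hs.2
    · intro t h1 h2
      rw [hFf _ (by simp; linarith), hFf _ h2.ne, hfl _ (by simp; linarith), hfl _ h2.le,
        laplaceDefect_reflect]
    · intro t h1 h2
      rw [hFf _ (by simp; linarith), hFf _ h1.ne', hfr _ (by simp; linarith), hfr _ h1,
        ← laplaceDefect_reflect lam nu2 (-t)]
      congr 2
      ring
    · intro ε hε
      set C : ℝ := 2 * lam + Real.pi * lam / 6 with hC
      have hCpos : 0 < C := by positivity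
      refine ⟨max 1 (C / ε), fun t h1 h2 hR => ?_⟩
      have hi1 : 1 ≤ |t.im| := (le_max_left _ _).trans hR
      have hi2 : C / |t.im| ≤ ε := by
        rw [div_le_iff₀ (by linarith), mul_comm, ← div_le_iff₀ hε]
        exact (le_max_right _ _).trans hR
      have ht0 : t ≠ 0 := by
        rintro rfl
        norm_num at hi1
      rw [hF, Function.update_of_ne ht0]
      refine le_trans ?_ hi2
      rcases le_or_gt t.re 0 with h | h
      · rw [hfl t h, hC, ← hm1]
        exact norm_laplaceDefect_le hlam hnu1 h1.le h hi1
      · rw [hfr t h, norm_neg, hC, ← hm2]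
        simpa using norm_laplaceDefect_le hlam hnu2 (t := -t) (by simpa using h2.le)
          (by simpa using h.le) (by simpa using hi1)
  constructor
  · have := hzero t ⟨ht₁, by linarith⟩
    rwa [hFf t ht₂.ne, hfl t ht₂.le] at this
  · have := hzero (-t) ⟨by simp; linarith, by simpa using neg_lt.1 ht₁⟩
    rw [hFf (-t) (by simpa using ht₂.ne), hfr (-t) (by simpa using ht₂)] at this
    simpa using this

end BAR

/-! ### Partial fractions and the boundary density -/

lemma sum_alternating_eq_cotTerm (t : ℂ) (N : ℕ) :
    ∑ n ∈ Finset.range (2 * N), (-1 : ℂ) ^ n * (1 / (t - n) - 1 / (t + n + 1))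
      = 1 / t + ∑ j ∈ Finset.range N, cotTerm (t / 2) j
        - ∑ j ∈ Finset.range (2 * N), cotTerm t j - 1 / (t - 2 * N) := by
  induction N with
  | zero => simp
  | succ N ih =>
    have h1 : (1 : ℂ) / (t / 2 - (N + 1)) = 2 / (t - 2 * (N + 1)) := by
      rw [show t / 2 - (N + 1) = (t - 2 * (N + 1)) / 2 by ring, one_div_div]
    have h2 : (1 : ℂ) / (t / 2 + (N + 1)) = 2 / (t + 2 * (N + 1)) := by
      rw [show t / 2 + (N + 1) = (t + 2 * (N + 1)) / 2 by ring, one_div_div]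
    rw [show 2 * (N + 1) = 2 * N + 1 + 1 by ring, Finset.sum_range_succ, Finset.sum_range_succ, ih,
      Finset.sum_range_succ (cotTerm t), Finset.sum_range_succ (cotTerm t),
      Finset.sum_range_succ (cotTerm (t / 2))]
    simp only [cotTerm, pow_succ, pow_mul]
    rw [h1, h2]
    push_cast
    rw [show t - ((2 : ℂ) * N + 1 + 1) = t - 2 * (N + 1) by ring,
      show t + ((2 : ℂ) * N + 1 + 1) = t + 2 * (N + 1) by ring,
      show t + ((2 : ℂ) * N + 1) + 1 = t + 2 * (N + 1) by ring,
      show t + (2 : ℂ) * N + 1 = t + (2 * N + 1) by ring]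
    simp only [pow_zero, one_mul, neg_mul, mul_neg, mul_one, neg_neg, one_pow]
    ring

/-- The partial fraction expansion of `π / sin (π t)`. -/
lemma tendsto_sum_pi_div_sin {t : ℂ} (ht : t ∈ Complex.integerComplement) :
    Tendsto (fun N : ℕ => ∑ n ∈ Finset.range (2 * N),
        (-1 : ℂ) ^ n * (1 / (t - n) - 1 / (t + n + 1)))
      atTop (𝓝 (Real.pi / sin (Real.pi * t))) := by
  have ht2 : t / 2 ∈ Complex.integerComplement := by
    rintro ⟨n, hn⟩
    refine ht ⟨2 * n, ?_⟩
    push_cast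
    rw [hn]
    ring
  have hdouble : Tendsto (fun N : ℕ => 2 * N) atTop atTop :=
    tendsto_id.const_mul_atTop' two_pos
  have h1 := tendsto_logDeriv_euler_cot_sub ht2
  have h2 := (tendsto_logDeriv_euler_cot_sub ht).comp hdouble
  have h3 : Tendsto (fun N : ℕ => 1 / (t - 2 * N)) atTop (𝓝 0) := by
    have hN : Tendsto (fun N : ℕ => ‖((2 * N : ℕ) : ℂ)‖) atTop atTop := by
      simp_rw [Complex.norm_natCast]
      exact tendsto_natCast_atTop_atTop.comp hdouble
    have hs : Tendsto (fun N : ℕ => t - ((2 * N : ℕ) : ℂ)) atTop (Bornology.cobounded ℂ) := by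
      rw [← tendsto_norm_atTop_iff_cobounded]
      refine tendsto_atTop_mono (fun N => ?_) (tendsto_atTop_add_const_right _ (-‖t‖) hN)
      rw [norm_sub_rev]
      linarith [norm_sub_norm_le ((2 * N : ℕ) : ℂ) t]
    refine (tendsto_inv₀_cobounded.comp hs).congr fun N => ?_
    simp
  have hlim := ((((tendsto_const_nhds (x := 1 / t)).add h1).sub h2).sub h3)
  have hval : 1 / t + (Real.pi * cot (Real.pi * (t / 2)) - 1 / (t / 2))
      - (Real.pi * cot (Real.pi * t) - 1 / t) - 0 = Real.pi / sin (Real.pi * t) := by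
    have hs := sin_pi_mul_ne_zero ht
    have hs2 := sin_pi_mul_ne_zero ht2
    have e1 : sin (Real.pi * t) = 2 * sin (Real.pi * (t / 2)) * cos (Real.pi * (t / 2)) := by
      rw [← sin_two_mul]; ring_nf
    have e2 : cos (Real.pi * t) = 2 * cos (Real.pi * (t / 2)) ^ 2 - 1 := by
      rw [← cos_two_mul]; ring_nf
    have hc2 : cos (Real.pi * (t / 2)) ≠ 0 := by
      intro h
      rw [h, mul_zero] at e1
      exact hs e1
    have ht0 : t ≠ 0 := integerComplement.ne_zero ht
    simp only [cot]
    rw [e1, e2]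
    generalize sin (Real.pi * (t / 2)) = S at *
    generalize cos (Real.pi * (t / 2)) = C at *
    field_simp
    ring
  rw [hval] at hlim
  refine hlim.congr fun N => ?_
  rw [sum_alternating_eq_cotTerm]
  rfl

/-- The coefficients of the boundary density, up to the factor `lam ^ 2`. -/
noncomputable def densityCoeff (n : ℕ) : ℝ :=
  -((-1 : ℝ) ^ n / 12) * ((n : ℝ) - 2) * ((n : ℝ) - 1) * n * ((n : ℝ) + 1) * ((n : ℝ) + 2)
    * ((n : ℝ) + 3) * (2 * (n : ℝ) + 1)

/-- The exponential rates in the boundary density. -/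
noncomputable def densityRate (lam : ℝ) (n : ℕ) : ℝ := (n : ℝ) * ((n : ℝ) + 1) / 2 * lam

lemma boundaryDensitySym_eq_tsum (lam u : ℝ) :
    boundaryDensitySym lam u
      = ∑' n : ℕ, lam ^ 2 * densityCoeff n * Real.exp (-(densityRate lam n * u)) := by
  rw [boundaryDensitySym, ← tsum_mul_left]
  refine tsum_congr fun n => ?_
  split_ifs with h
  · obtain ⟨k, rfl⟩ : ∃ k, n = k + 1 := ⟨n - 1, by omega⟩
    simp only [densityCoeff, densityRate, Nat.add_sub_cancel, pow_succ]
    ring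
  · have h0 : densityCoeff n = 0 := by
      have : n < 3 := by omega
      interval_cases n <;> norm_num [densityCoeff]
    simp [h0]

/-- The real partial fraction terms of the boundary Laplace transform. -/
noncomputable def boundaryTerm (lam : ℝ) (n : ℕ) (y : ℝ) : ℝ :=
  lam / 6 * ((2 * y / lam) * (2 * y / lam + 2) * (2 * y / lam + 6)) * ((-1) ^ n * (2 * n + 1))
    * (lam / 2) / (y + densityRate lam n)

lemma densityRate_nonneg {lam : ℝ} (hlam : 0 < lam) (n : ℕ) : 0 ≤ densityRate lam n := by
  unfold densityRate; positivity

lemma tendsto_sum_boundaryTerm {lam : ℝ} (hlam : 0 < lam) {ν : Measure ℝ}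
    (hzero : ∀ t : ℂ, -1 < t.re → t.re < 0 → laplaceDefect lam ν t = 0) {y : ℝ}
    (hy : lam ≤ y) :
    Tendsto (fun N : ℕ => ∑ n ∈ Finset.range (2 * N), boundaryTerm lam n y) atTop
      (𝓝 (∫ u, Real.exp (-y * u) ∂ν)) := by
  have hlC : (lam : ℂ) ≠ 0 := ofReal_ne_zero.2 hlam.ne'
  have hy0 : 0 < y := by linarith
  have hz : 0 ≤ 2 * y / lam - 1 / 4 := by
    have : 2 ≤ 2 * y / lam := by rw [le_div_iff₀ hlam]; linarith
    linarith
  set r : ℝ := Real.sqrt (2 * y / lam - 1 / 4) with hr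
  have hr2 : (r : ℂ) ^ 2 = 2 * y / lam - 1 / 4 := by
    have := Real.sq_sqrt hz
    rw [← hr] at this
    rw [← ofReal_pow, this]
    push_cast
    ring
  set t : ℂ := -1 / 2 + r * I with ht
  have htre : t.re = -1 / 2 := by
    rw [ht, show (-1 / 2 + r * I : ℂ) = ((-1 / 2 : ℝ) : ℂ) + r * I by push_cast; ring]
    simp
  have htt : t * (t + 1) = -(2 * y / lam) := by
    rw [ht]
    linear_combination (r : ℂ) ^ 2 * I_sq - hr2
  have hY : uniformY lam t = y := by
    rw [uniformY, htt]
    field_simp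
  have htZ : t ∈ Complex.integerComplement := by
    rintro ⟨n, hn⟩
    have h := congrArg re hn
    rw [htre, intCast_re] at h
    have h2 : (2 * n : ℝ) = -1 := by linarith
    have h3 : 2 * n = -1 := by exact_mod_cast h2
    omega
  have ht0 : t ≠ 0 := integerComplement.ne_zero htZ
  have hP := sexticPoly_ne_zero (t := t) (by rw [htre]; norm_num) (by rw [htre]; norm_num) ht0
  have hS := sin_pi_mul_ne_zero htZ
  have hL : laplaceC ν y = lam / 6 * sexticPoly t * (Real.pi / sin (Real.pi * t)) := by
    have h := hzero t (by rw [htre]; norm_num) (by rw [htre]; norm_num)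
    rw [laplaceDefect, hY, sub_eq_zero, div_eq_iff hP] at h
    rw [h]
    ring
  have hlim := (tendsto_sum_pi_div_sin htZ).const_mul (lam / 6 * sexticPoly t : ℂ)
  rw [← hL, laplaceC_ofReal] at hlim
  have hcast : ∀ N : ℕ, (lam / 6 * sexticPoly t : ℂ) * ∑ n ∈ Finset.range (2 * N),
        (-1 : ℂ) ^ n * (1 / (t - n) - 1 / (t + n + 1))
      = ((∑ n ∈ Finset.range (2 * N), boundaryTerm lam n y : ℝ) : ℂ) := by
    intro N
    rw [Finset.mul_sum, ofReal_sum]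
    refine Finset.sum_congr rfl fun n _ => ?_
    have hpos : 0 < y + densityRate lam n := by linarith [densityRate_nonneg hlam n]
    have hposC : ((y : ℂ) + densityRate lam n) ≠ 0 := by exact_mod_cast hpos.ne'
    have e1 : t - n ≠ 0 := by
      simpa [sub_eq_add_neg] using integerComplement_add_ne_zero htZ (-n)
    have e2 : t + n + 1 ≠ 0 := by
      simpa [add_assoc] using integerComplement_add_ne_zero htZ (n + 1)
    have hprod : (t - n) * (t + n + 1) = -(2 / lam) * (y + densityRate lam n) := by
      have : (t - n) * (t + n + 1) = t * (t + 1) - n * (n + 1) := by ring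
      rw [this, htt, densityRate]
      push_cast
      field_simp
      ring
    have hfrac : 1 / (t - n) - 1 / (t + n + 1)
        = (2 * n + 1) * (-(lam / 2)) / (y + densityRate lam n) := by
      rw [div_sub_div _ _ e1 e2, hprod]
      field_simp
      ring
    have hP' : sexticPoly t
        = -((2 * y / lam) * (2 * y / lam + 2) * (2 * y / lam + 6)) := by
      have : sexticPoly t = (t * (t + 1)) * (t * (t + 1) - 2) * (t * (t + 1) - 6) := by
        simp only [sexticPoly]; ring
      rw [this, htt]
      ring
    rw [hfrac, hP', boundaryTerm]
    push_cast
    ring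
  have hre := (continuous_re.tendsto _).comp hlim
  refine (hre.congr fun N => ?_)
  simp only [Function.comp, hcast, ofReal_re]

/-- The integral `∫ (1 - e^{-u})^4 e^{-s u} du` over the half-line. -/
noncomputable def betaKernel (s : ℝ) : ℝ := 24 / (s * (s + 1) * (s + 2) * (s + 3) * (s + 4))

lemma fourth_difference_boundaryTerm {lam : ℝ} (hlam : 0 < lam) (n : ℕ) {y : ℝ} (hy : 0 < y) :
    boundaryTerm lam n y - 4 * boundaryTerm lam n (y + 1) + 6 * boundaryTerm lam n (y + 2)
        - 4 * boundaryTerm lam n (y + 3) + boundaryTerm lam n (y + 4)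
      = lam ^ 2 * densityCoeff n * betaKernel (y + densityRate lam n) := by
  have hsplit : ∀ x : ℝ, 0 < x → boundaryTerm lam n x
      = lam / 6 * ((-1) ^ n * (2 * n + 1)) * ((2 * x / lam) ^ 2
          + (8 - (n : ℝ) * (n + 1)) * (2 * x / lam)
          + (((n : ℝ) * (n + 1)) ^ 2 - 8 * ((n : ℝ) * (n + 1)) + 12))
        + lam ^ 2 * densityCoeff n * (1 / (x + densityRate lam n)) := by
    intro x hx
    have hpos : x + densityRate lam n ≠ 0 := by linarith [densityRate_nonneg hlam n]
    rw [boundaryTerm, div_eq_iff hpos, add_mul, mul_assoc (lam ^ 2 * densityCoeff n),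
      one_div_mul_cancel hpos, densityRate, densityCoeff]
    field_simp
    ring
  have hk : betaKernel (y + densityRate lam n)
      = 1 / (y + densityRate lam n) - 4 * (1 / (y + 1 + densityRate lam n))
        + 6 * (1 / (y + 2 + densityRate lam n)) - 4 * (1 / (y + 3 + densityRate lam n))
        + 1 / (y + 4 + densityRate lam n) := by
    have h := densityRate_nonneg hlam n
    generalize densityRate lam n = a at h ⊢
    have e0 : y + a ≠ 0 := by positivity
    have e1 : y + a + 1 ≠ 0 := by positivity
    have e2 : y + a + 2 ≠ 0 := by positivity
    have e3 : y + a + 3 ≠ 0 := by positivity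
    have e4 : y + a + 4 ≠ 0 := by positivity
    rw [betaKernel, add_right_comm y 1, add_right_comm y 2, add_right_comm y 3,
      add_right_comm y 4]
    field_simp
    ring
  rw [hsplit y hy, hsplit (y + 1) (by linarith), hsplit (y + 2) (by linarith),
    hsplit (y + 3) (by linarith), hsplit (y + 4) (by linarith), hk]
  ring

lemma expand_weight (s u : ℝ) :
    (1 - Real.exp (-u)) ^ 4 * Real.exp (-s * u)
      = Real.exp (-s * u) - 4 * Real.exp (-(s + 1) * u) + 6 * Real.exp (-(s + 2) * u)
        - 4 * Real.exp (-(s + 3) * u) + Real.exp (-(s + 4) * u) := by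
  have e1 : Real.exp (-(s + 1) * u) = Real.exp (-s * u) * Real.exp (-u) := by
    rw [← Real.exp_add]; ring_nf
  have e2 : Real.exp (-(s + 2) * u) = Real.exp (-s * u) * Real.exp (-u) ^ 2 := by
    rw [← Real.exp_nat_mul, ← Real.exp_add]; push_cast; ring_nf
  have e3 : Real.exp (-(s + 3) * u) = Real.exp (-s * u) * Real.exp (-u) ^ 3 := by
    rw [← Real.exp_nat_mul, ← Real.exp_add]; push_cast; ring_nf
  have e4 : Real.exp (-(s + 4) * u) = Real.exp (-s * u) * Real.exp (-u) ^ 4 := by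
    rw [← Real.exp_nat_mul, ← Real.exp_add]; push_cast; ring_nf
  rw [e1, e2, e3, e4]
  ring

lemma integrable_integral_weight {μ : Measure ℝ} {s : ℝ}
    (h : ∀ x, s ≤ x → Integrable (fun u => Real.exp (-x * u)) μ) :
    Integrable (fun u => (1 - Real.exp (-u)) ^ 4 * Real.exp (-s * u)) μ ∧
    ∫ u, (1 - Real.exp (-u)) ^ 4 * Real.exp (-s * u) ∂μ
      = (∫ u, Real.exp (-s * u) ∂μ) - 4 * (∫ u, Real.exp (-(s + 1) * u) ∂μ)
        + 6 * (∫ u, Real.exp (-(s + 2) * u) ∂μ) - 4 * (∫ u, Real.exp (-(s + 3) * u) ∂μ)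
        + ∫ u, Real.exp (-(s + 4) * u) ∂μ := by
  have i0 := h s le_rfl
  have i1 := (h (s + 1) (by linarith)).const_mul 4
  have i2 := (h (s + 2) (by linarith)).const_mul 6
  have i3 := (h (s + 3) (by linarith)).const_mul 4
  have i4 := h (s + 4) (by linarith)
  simp_rw [expand_weight]
  have j1 : Integrable (fun u => Real.exp (-s * u) - 4 * Real.exp (-(s + 1) * u)) μ := i0.sub i1
  have j2 : Integrable (fun u => Real.exp (-s * u) - 4 * Real.exp (-(s + 1) * u)
      + 6 * Real.exp (-(s + 2) * u)) μ := j1.add i2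
  have j3 : Integrable (fun u => Real.exp (-s * u) - 4 * Real.exp (-(s + 1) * u)
      + 6 * Real.exp (-(s + 2) * u) - 4 * Real.exp (-(s + 3) * u)) μ := j2.sub i3
  refine ⟨j3.add i4, ?_⟩
  rw [integral_add j3 i4, integral_sub j2 i3, integral_add j1 i2, integral_sub i0 i1,
    integral_const_mul, integral_const_mul, integral_const_mul]

lemma integral_weight_Ioi {s : ℝ} (hs : 0 < s) :
    IntegrableOn (fun u => (1 - Real.exp (-u)) ^ 4 * Real.exp (-s * u)) (Ioi 0) ∧
    ∫ u in Ioi (0:ℝ), (1 - Real.exp (-u)) ^ 4 * Real.exp (-s * u) = betaKernel s := by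
  obtain ⟨h1, h2⟩ := integrable_integral_weight (μ := volume.restrict (Ioi 0)) (s := s)
    fun x hx => integrableOn_exp_mul_Ioi (by linarith) 0
  refine ⟨h1, ?_⟩
  have key : ∀ x : ℝ, 0 < x → ∫ u in Ioi (0:ℝ), Real.exp (-x * u) = 1 / x := by
    intro x hx
    rw [integral_exp_mul_Ioi (by linarith)]
    simp
  rw [h2, key s hs, key _ (by linarith), key _ (by linarith), key _ (by linarith),
    key _ (by linarith), betaKernel]
  field_simp
  ring

/-! ### Densities -/

lemma integrable_tsum_of_summable_integral_norm {α : Type*} [MeasurableSpace α] {μ : Measure α}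
    {F : ℕ → α → ℝ} (hF : ∀ i, Integrable (F i) μ) (hs : Summable fun i => ∫ a, ‖F i a‖ ∂μ) :
    Integrable (fun a => ∑' i, F i a) μ := by
  have hlin : ∫⁻ a, ∑' i, ‖F i a‖ₑ ∂μ < ⊤ := by
    rw [lintegral_tsum fun i => (hF i).1.enorm]
    simp_rw [← ofReal_integral_norm_eq_lintegral_enorm (hF _)]
    exact hs.tsum_ofReal_lt_top
  have hae : ∀ᵐ a ∂μ, Summable fun i => F i a := by
    filter_upwards [ae_lt_top' (AEMeasurable.tsum fun i => (hF i).1.enorm) hlin.ne]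
      with a ha
    exact Summable.of_nnnorm (ENNReal.tsum_coe_ne_top_iff_summable.1 ha.ne)
  refine ⟨aestronglyMeasurable_of_tendsto_ae (f := fun N a => ∑ i ∈ Finset.range N, F i a) atTop
    (fun N => Finset.aestronglyMeasurable_fun_sum _ fun i _ => (hF i).1) ?_, ?_⟩
  · filter_upwards [hae] with a ha
    exact ha.hasSum.tendsto_sum_nat
  · exact (lintegral_mono fun a => enorm_tsum_le_tsum_enorm).trans_lt hlin

lemma betaKernel_nonneg {s : ℝ} (hs : 0 < s) : 0 ≤ betaKernel s := by
  unfold betaKernel; positivity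

lemma betaKernel_le {s : ℝ} (hs : 0 < s) : betaKernel s ≤ 24 / s ^ 5 := by
  have h : s ^ 5 ≤ s * (s + 1) * (s + 2) * (s + 3) * (s + 4) := by
    calc s ^ 5 = s * s * s * s * s := by ring
      _ ≤ _ := by gcongr <;> linarith
  unfold betaKernel
  gcongr

lemma abs_densityCoeff_le (n : ℕ) : |densityCoeff n| ≤ 3 ^ 7 / 12 * ((n : ℝ) + 1) ^ 7 := by
  have hn : (0 : ℝ) ≤ n := n.cast_nonneg
  have key : ∀ a : ℝ, -(3 * ((n : ℝ) + 1)) ≤ a → a ≤ 3 * ((n : ℝ) + 1) →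
      |a| ≤ 3 * ((n : ℝ) + 1) := fun a h₁ h₂ => abs_le.2 ⟨h₁, h₂⟩
  have h1 := key ((n : ℝ) - 2) (by linarith) (by linarith)
  have h2 := key ((n : ℝ) - 1) (by linarith) (by linarith)
  have h3 := key (n : ℝ) (by linarith) (by linarith)
  have h4 := key ((n : ℝ) + 1) (by linarith) (by linarith)
  have h5 := key ((n : ℝ) + 2) (by linarith) (by linarith)
  have h6 := key ((n : ℝ) + 3) (by linarith) (by linarith)
  have h7 := key (2 * (n : ℝ) + 1) (by linarith) (by linarith)
  have h0 : |-((-1 : ℝ) ^ n / 12)| = 1 / 12 := by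
    rw [abs_neg, abs_div, abs_neg_one_pow]
    norm_num
  rw [densityCoeff]
  simp only [abs_mul]
  rw [h0]
  calc _ ≤ 1 / 12 * (3 * ((n : ℝ) + 1)) * (3 * ((n : ℝ) + 1)) * (3 * ((n : ℝ) + 1))
        * (3 * ((n : ℝ) + 1)) * (3 * ((n : ℝ) + 1)) * (3 * ((n : ℝ) + 1))
        * (3 * ((n : ℝ) + 1)) := by gcongr
    _ = _ := by ring

lemma summable_densityCoeff_mul_betaKernel {lam y : ℝ} (hlam : 0 < lam) (hy : lam ≤ y) :
    Summable fun n => lam ^ 2 * |densityCoeff n| * betaKernel (y + densityRate lam n) := by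
  have hsum : Summable fun n : ℕ => lam ^ 2 * (3 ^ 7 / 12) * (24 / (lam / 4) ^ 5)
      * (1 / ((n : ℝ) + 1) ^ 3) := by
    refine Summable.mul_left _ ?_
    have := (summable_nat_add_iff 1).2 (Real.summable_one_div_nat_pow.2 (by norm_num : 1 < 3))
    simpa using this
  have hpos : ∀ n, 0 < y + densityRate lam n := fun n => by
    linarith [densityRate_nonneg hlam n]
  refine Summable.of_nonneg_of_le (fun n => ?_) (fun n => ?_) hsum
  · have := betaKernel_nonneg (hpos n)
    positivity
  · have hrate : lam / 4 * ((n : ℝ) + 1) ^ 2 ≤ y + densityRate lam n := by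
      unfold densityRate
      nlinarith [mul_nonneg hlam.le (sq_nonneg (n : ℝ))]
    have hb : betaKernel (y + densityRate lam n) ≤ 24 / (lam / 4 * ((n : ℝ) + 1) ^ 2) ^ 5 :=
      (betaKernel_le (hpos n)).trans (by gcongr)
    calc _ ≤ lam ^ 2 * (3 ^ 7 / 12 * ((n : ℝ) + 1) ^ 7)
          * (24 / (lam / 4 * ((n : ℝ) + 1) ^ 2) ^ 5) := by
          have := betaKernel_nonneg (hpos n)
          have := abs_densityCoeff_le n
          gcongr
      _ = _ := by field_simp

lemma integral_weight_boundaryDensitySym {lam y : ℝ} (hlam : 0 < lam) (hy : lam ≤ y) :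
    IntegrableOn (fun u => (1 - Real.exp (-u)) ^ 4 * Real.exp (-y * u)
      * boundaryDensitySym lam u) (Ioi 0) ∧
    HasSum (fun n => lam ^ 2 * densityCoeff n * betaKernel (y + densityRate lam n))
      (∫ u in Ioi (0:ℝ), (1 - Real.exp (-u)) ^ 4 * Real.exp (-y * u)
        * boundaryDensitySym lam u) := by
  set F : ℕ → ℝ → ℝ := fun n u => lam ^ 2 * densityCoeff n
    * ((1 - Real.exp (-u)) ^ 4 * Real.exp (-(y + densityRate lam n) * u)) with hFdef
  have hpos : ∀ n, 0 < y + densityRate lam n := fun n => by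
    linarith [densityRate_nonneg hlam n]
  have hF : ∀ n, Integrable (F n) (volume.restrict (Ioi 0)) := fun n =>
    (integral_weight_Ioi (hpos n)).1.const_mul _
  have hFi : ∀ n, ∫ u in Ioi (0:ℝ), F n u
      = lam ^ 2 * densityCoeff n * betaKernel (y + densityRate lam n) := fun n => by
    simp only [hFdef]
    rw [integral_const_mul, (integral_weight_Ioi (hpos n)).2]
  have hFn : ∀ n, ∫ u in Ioi (0:ℝ), ‖F n u‖
      = lam ^ 2 * |densityCoeff n| * betaKernel (y + densityRate lam n) := fun n => by
    rw [← (integral_weight_Ioi (hpos n)).2, ← integral_const_mul]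
    congr 1 with u
    rw [hFdef, Real.norm_eq_abs, abs_mul, abs_mul, abs_of_nonneg (sq_nonneg lam),
      abs_of_nonneg (mul_nonneg (by positivity) (Real.exp_pos _).le)]
  have hs : Summable fun n => ∫ u in Ioi (0:ℝ), ‖F n u‖ := by
    simp_rw [hFn]
    exact summable_densityCoeff_mul_betaKernel hlam hy
  have heq : (fun u => (1 - Real.exp (-u)) ^ 4 * Real.exp (-y * u) * boundaryDensitySym lam u)
      = fun u => ∑' n, F n u := by
    funext u
    rw [boundaryDensitySym_eq_tsum, ← tsum_mul_left]
    refine tsum_congr fun n => ?_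
    simp only [hFdef]
    rw [show -(y + densityRate lam n) * u = -y * u + -(densityRate lam n * u) by ring,
      Real.exp_add]
    ring
  rw [heq]
  refine ⟨integrable_tsum_of_summable_integral_norm hF hs, ?_⟩
  simpa only [hFi] using hasSum_integral_of_summable_integral_norm hF hs

lemma integrable_real_exp_neg_mul {ν : Measure ℝ} [IsFiniteMeasure ν] (hν : ∀ᵐ u ∂ν, 0 ≤ u)
    {x : ℝ} (hx : 0 ≤ x) : Integrable (fun u => Real.exp (-x * u)) ν := by
  refine Integrable.of_bound (C := 1) (by fun_prop) ?_
  filter_upwards [hν] with u hu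
  rw [Real.norm_of_nonneg (Real.exp_pos _).le]
  exact Real.exp_le_one_iff.2 (by nlinarith)

lemma integral_weight_eq {lam y : ℝ} (hlam : 0 < lam) {ν : Measure ℝ} [IsFiniteMeasure ν]
    (hν : ∀ᵐ u ∂ν, 0 ≤ u)
    (hzero : ∀ t : ℂ, -1 < t.re → t.re < 0 → laplaceDefect lam ν t = 0) (hy : lam ≤ y) :
    ∫ u, (1 - Real.exp (-u)) ^ 4 * Real.exp (-y * u) ∂ν
      = ∫ u in Ioi (0:ℝ), (1 - Real.exp (-u)) ^ 4 * Real.exp (-y * u)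
        * boundaryDensitySym lam u := by
  have hdouble : Tendsto (fun N : ℕ => 2 * N) atTop atTop :=
    tendsto_id.const_mul_atTop' two_pos
  have h := (integral_weight_boundaryDensitySym hlam hy).2.tendsto_sum_nat.comp hdouble
  refine tendsto_nhds_unique ?_ h
  rw [(integrable_integral_weight fun x hx =>
    integrable_real_exp_neg_mul hν (by linarith : 0 ≤ x)).2]
  have hL : ∀ j : ℝ, 0 ≤ j → Tendsto
      (fun N : ℕ => ∑ n ∈ Finset.range (2 * N), boundaryTerm lam n (y + j)) atTop
      (𝓝 (∫ u, Real.exp (-(y + j) * u) ∂ν)) := fun j hj =>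
    tendsto_sum_boundaryTerm hlam hzero (by linarith)
  refine (((((tendsto_sum_boundaryTerm hlam hzero hy).sub ((hL 1 (by norm_num)).const_mul 4)).add
    ((hL 2 (by norm_num)).const_mul 6)).sub ((hL 3 (by norm_num)).const_mul 4)).add
    (hL 4 (by norm_num))).congr fun N => ?_
  simp only [Function.comp, Finset.mul_sum, ← Finset.sum_sub_distrib, ← Finset.sum_add_distrib]
  exact Finset.sum_congr rfl fun n _ => fourth_difference_boundaryTerm hlam n (by linarith)

/-- A positive measure whose density with respect to `μ` is formally `f` has density `f`. -/
lemma eq_withDensity_ofReal_of_add_eq {α : Type*} [MeasurableSpace α] {μ A : Measure α}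
    [SigmaFinite μ] {f : α → ℝ} (hf : AEMeasurable f μ)
    (h : A + μ.withDensity (fun u => ENNReal.ofReal (-f u))
      = μ.withDensity fun u => ENNReal.ofReal (f u)) :
    A = μ.withDensity fun u => ENNReal.ofReal (f u) := by
  have hle : (fun u => ENNReal.ofReal (-f u)) ≤ᵐ[μ] fun u => ENNReal.ofReal (f u) := by
    refine ae_le_of_forall_setLIntegral_le_of_sigmaFinite₀ hf.neg.ennreal_ofReal fun s hs _ => ?_
    rw [← withDensity_apply _ hs, ← withDensity_apply _ hs, ← h]
    exact Measure.le_add_left le_rfl s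
  have hzero : (fun u => ENNReal.ofReal (-f u)) =ᵐ[μ] 0 := by
    filter_upwards [hle] with u hu
    rcases le_total 0 (f u) with h0 | h0
    · simp [h0]
    · simpa [ENNReal.ofReal_of_nonpos h0] using hu
  rwa [withDensity_congr_ae hzero, withDensity_zero, add_zero] at h

lemma integral_withDensity_ofReal {α : Type*} [MeasurableSpace α] {μ : Measure α} {f : α → ℝ}
    (hf : AEMeasurable f μ) (g : α → ℝ) :
    ∫ u, g u ∂μ.withDensity (fun u => ENNReal.ofReal (f u)) = ∫ u, max (f u) 0 * g u ∂μ := by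
  rw [integral_withDensity_eq_integral_toReal_smul₀ hf.ennreal_ofReal
    (.of_forall fun _ => ENNReal.ofReal_lt_top)]
  simp only [ENNReal.toReal_ofReal', smul_eq_mul]

/-- A finite measure on the half-line has density `d` as soon as the weighted Laplace
transforms agree, for some positive weight. -/
lemma eq_withDensity_of_laplace_eq {ν μ : Measure ℝ} [IsFiniteMeasure ν] [SigmaFinite μ]
    (hν : ∀ᵐ u ∂ν, 0 < u) (hμ : ∀ᵐ u ∂μ, 0 < u) {d W : ℝ → ℝ} (hW : Measurable W)
    (hWpos : ∀ u, 0 < u → 0 < W u) (hWν : Integrable W ν)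
    (hd : Integrable (fun u => W u * d u) μ)
    (h : ∀ x : ℝ, 0 < x → ∫ u, W u * Real.exp (-x * u) ∂ν
      = ∫ u, W u * d u * Real.exp (-x * u) ∂μ) :
    ν = μ.withDensity fun u => ENNReal.ofReal (d u) := by
  have hdm : AEMeasurable d μ := by
    refine (hd.aemeasurable.div hW.aemeasurable).congr ?_
    filter_upwards [hμ] with u hu
    have := (hWpos u hu).ne'
    simp only [Pi.div_apply]
    field_simp
  have hf := hd.aemeasurable
  have : IsFiniteMeasure (ν.withDensity fun u => ENNReal.ofReal (W u)) :=
    isFiniteMeasure_withDensity_ofReal hWν.2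
  have : IsFiniteMeasure (μ.withDensity fun u => ENNReal.ofReal (W u * d u)) :=
    isFiniteMeasure_withDensity_ofReal hd.2
  have : IsFiniteMeasure (μ.withDensity fun u => ENNReal.ofReal (-(W u * d u))) :=
    isFiniteMeasure_withDensity_ofReal hd.neg.2
  have hnn : ∀ {m : Measure ℝ} (g : ℝ → ENNReal), (∀ᵐ u ∂m, 0 < u) →
      ∀ᵐ u ∂m.withDensity g, 0 ≤ u := fun g hm =>
    (withDensity_absolutelyContinuous _ g).ae_le (hm.mono fun _ hu => le_of_lt hu)
  have hsum : (ν.withDensity fun u => ENNReal.ofReal (W u))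
      + μ.withDensity (fun u => ENNReal.ofReal (-(W u * d u)))
      = μ.withDensity fun u => ENNReal.ofReal (W u * d u) := by
    refine measure_eq_of_laplaceC_eq ?_ (hnn _ hμ) 0 fun x hx _ => ?_
    · exact ae_add_measure_iff.2 ⟨hnn _ hν, hnn _ hμ⟩
    have hdx : ∀ {g : ℝ → ℝ}, Integrable g μ →
        Integrable (fun u => g u * Real.exp (-x * u)) μ := by
      intro g hg
      refine hg.mul_bdd (c := 1) (by fun_prop) ?_
      filter_upwards [hμ] with u hu
      rw [Real.norm_of_nonneg (Real.exp_pos _).le]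
      exact Real.exp_le_one_iff.2 (by nlinarith)
    rw [laplaceC_ofReal, laplaceC_ofReal, integral_add_measure
      (integrable_real_exp_neg_mul (hnn _ hν) hx.le)
      (integrable_real_exp_neg_mul (hnn _ hμ) hx.le),
      integral_withDensity_ofReal hf,
      integral_withDensity_ofReal (f := fun u => -(W u * d u)) hf.neg,
      integral_withDensity_ofReal hW.aemeasurable]
    congr 1
    have hWe : ∫ u, max (W u) 0 * Real.exp (-x * u) ∂ν = ∫ u, W u * Real.exp (-x * u) ∂ν := by
      refine integral_congr_ae ?_
      filter_upwards [hν] with u hu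
      rw [max_eq_left (hWpos u hu).le]
    rw [hWe, h x hx, ← eq_sub_iff_add_eq, ← integral_sub (hdx hd.pos_part) (hdx hd.neg_part)]
    congr 1 with u
    rw [← sub_mul]
    congr 1
    rcases le_total 0 (W u * d u) with h0 | h0
    · rw [max_eq_left h0, max_eq_right (neg_nonpos.2 h0), sub_zero]
    · rw [max_eq_right h0, max_eq_left (neg_nonneg.2 h0), zero_sub, neg_neg]
  have hA := eq_withDensity_ofReal_of_add_eq hf hsum
  have hB : (μ.withDensity fun u => ENNReal.ofReal (W u * d u))
      = (μ.withDensity fun u => ENNReal.ofReal (d u)).withDensity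
        fun u => ENNReal.ofReal (W u) := by
    rw [← withDensity_mul₀ hdm.ennreal_ofReal hW.ennreal_ofReal.aemeasurable]
    refine withDensity_congr_ae ?_
    filter_upwards [hμ] with u hu
    rw [Pi.mul_apply, mul_comm, ENNReal.ofReal_mul' (hWpos u hu).le]
  have hne : ∀ {m : Measure ℝ}, (∀ᵐ u ∂m, 0 < u) → ∀ᵐ u ∂m, ENNReal.ofReal (W u) ≠ 0 :=
    fun hm => hm.mono fun u hu => (ENNReal.ofReal_pos.2 (hWpos u hu)).ne'
  rw [hB] at hA
  have hcancel := congrArg (fun m => m.withDensity fun u => (ENNReal.ofReal (W u))⁻¹) hA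
  rwa [withDensity_inv_same hW.ennreal_ofReal (hne hν) (.of_forall fun _ => ENNReal.ofReal_ne_top),
    withDensity_inv_same hW.ennreal_ofReal
      (hne ((withDensity_absolutelyContinuous _ _).ae_le hμ))
      (.of_forall fun _ => ENNReal.ofReal_ne_top)] at hcancel

lemma eq_withDensity_boundaryDensitySym {lam : ℝ} (hlam : 0 < lam) {ν : Measure ℝ}
    [IsFiniteMeasure ν] (hν : ∀ᵐ u ∂ν, 0 < u)
    (hzero : ∀ t : ℂ, -1 < t.re → t.re < 0 → laplaceDefect lam ν t = 0) :
    ν = (volume.restrict (Ioi (0:ℝ))).withDensity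
      fun u => ENNReal.ofReal (boundaryDensitySym lam u) := by
  have hν0 : ∀ᵐ u ∂ν, 0 ≤ u := hν.mono fun _ hu => le_of_lt hu
  refine eq_withDensity_of_laplace_eq (μ := volume.restrict (Ioi (0:ℝ)))
    (W := fun u => (1 - Real.exp (-u)) ^ 4 * Real.exp (-lam * u))
    hν (ae_restrict_mem measurableSet_Ioi) (by fun_prop) (fun u hu => ?_)
    (integrable_integral_weight fun x hx =>
      integrable_real_exp_neg_mul hν0 (by linarith : 0 ≤ x)).1
    (integral_weight_boundaryDensitySym hlam le_rfl).1 fun x hx => ?_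
  · have : 0 < 1 - Real.exp (-u) := by
      rw [sub_pos, Real.exp_lt_one_iff]; linarith
    positivity
  · have key := integral_weight_eq hlam hν0 hzero (y := lam + x) (by linarith)
    have hexp : ∀ u : ℝ, Real.exp (-(lam + x) * u)
        = Real.exp (-lam * u) * Real.exp (-x * u) := fun u => by
      rw [← Real.exp_add]; ring_nf
    simp_rw [hexp] at key
    refine (integral_congr_ae (.of_forall fun u => ?_)).trans
      (key.trans (integral_congr_ae (.of_forall fun u => ?_)))
    · simp only [mul_assoc]
    · simp only
      ring

end LaplaceTransform

/-- Corollary (density on the boundary, symmetric case): if `λ1 = λ2 = λ > 0` and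
`(π, ν1, ν2)` satisfies the basic adjoint relationship, then for `i ∈ {1,2}` the measure
`νi` is absolutely continuous with respect to Lebesgue measure on `(0,∞)` with the
stated density. -/
theorem boundary_density_symmetric
    (lam : ℝ) (hlam : 0 < lam)
    (pim : Measure (ℝ × ℝ)) [IsProbabilityMeasure pim]
    (hpim : pim ((Ioi (0:ℝ) ×ˢ Ioi (0:ℝ))ᶜ) = 0)
    (nu1 nu2 : Measure ℝ) [IsFiniteMeasure nu1] [IsFiniteMeasure nu2]
    (hnu1 : nu1 (Ioi (0:ℝ))ᶜ = 0) (hnu2 : nu2 (Ioi (0:ℝ))ᶜ = 0)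
    (hBAR : ∀ x ≥ (0:ℝ), ∀ y ≥ (0:ℝ),
      ((x - y) ^ 2 + lam * x + lam * y) * (∫ p, Real.exp (-x * p.1 - y * p.2) ∂pim)
        = (x - y / 2) * (∫ u, Real.exp (-y * u) ∂nu1)
          + (y - x / 2) * (∫ u, Real.exp (-x * u) ∂nu2)) :
    nu1 = (volume.restrict (Ioi (0:ℝ))).withDensity
        (fun u => ENNReal.ofReal (boundaryDensitySym lam u)) ∧
    nu2 = (volume.restrict (Ioi (0:ℝ))).withDensity
        (fun u => ENNReal.ofReal (boundaryDensitySym lam u)) := by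
  have hpos : ∀ {ν : Measure ℝ}, ν (Ioi (0:ℝ))ᶜ = 0 → ∀ᵐ u ∂ν, 0 < u := fun h => h
  have hp : ∀ᵐ p ∂pim, p ∈ Ioi (0:ℝ) ×ˢ Ioi (0:ℝ) := hpim
  have h₁ : ∀ᵐ p ∂pim, 0 ≤ p.1 := hp.mono fun p hp => le_of_lt hp.1
  have h₂ : ∀ᵐ p ∂pim, 0 ≤ p.2 := hp.mono fun p hp => le_of_lt hp.2
  have hn1 : ∀ᵐ u ∂nu1, 0 ≤ u := (hpos hnu1).mono fun _ hu => le_of_lt hu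
  have hn2 : ∀ᵐ u ∂nu2, 0 ≤ u := (hpos hnu2).mono fun _ hu => le_of_lt hu
  have hmx : lam = nu1.real univ - nu2.real univ / 2 := by
    refine mass_relation measurable_fst h₁ hn2 fun x hx => ?_
    have h := hBAR x hx.le 0 le_rfl
    simp only [neg_zero, zero_mul, sub_zero, Real.exp_zero, integral_const, smul_eq_mul,
      mul_one] at h
    linear_combination h
  have hmy : lam = nu2.real univ - nu1.real univ / 2 := by
    refine mass_relation measurable_snd h₂ hn1 fun y hy => ?_
    have h := hBAR 0 le_rfl y hy.le
    simp only [neg_zero, zero_mul, zero_sub, Real.exp_zero, integral_const, smul_eq_mul,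
      mul_one, ← neg_mul] at h
    linear_combination h
  have hbar : ∀ x y : ℂ, 0 < x.re → 0 < y.re → (x - y) ^ 2 + lam * x + lam * y = 0 →
      (x - y / 2) * laplaceC nu1 y + (y - x / 2) * laplaceC nu2 x = 0 := by
    intro x y hx hy h0
    rw [← bar_complex h₁ h₂ hn1 hn2 hBAR hx hy, h0, zero_mul]
  have hzero := fun (t : ℂ) (ht₁ : -1 < t.re) (ht₂ : t.re < 0) =>
    laplaceDefect_eq_zero_of_bar hlam hn1 hn2 (by linarith) (by linarith) hbar ht₁ ht₂
  exact ⟨eq_withDensity_boundaryDensitySym hlam (hpos hnu1) fun t h h' => (hzero t h h').1,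
    eq_withDensity_boundaryDensitySym hlam (hpos hnu2) fun t h h' => (hzero t h h').2⟩
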